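/- Let ζ ∈ ℂ with Im ζ > 0. Let (x_n)_{n∈ℤ} be an injective family of points in ℝ³ such that every compact subset of ℝ³ contains only finitely many accumulation points of the set {x_n : n ∈ ℤ}, and let c : ℤ → ℂ satisfy Σ_{n∈ℤ} |c_n| < ∞. Let w ∈ L²(ℝ³) and suppose that for almost every x ∈ ℝ³: (1/4π) ∫_{ℝ³} (e^{iζ|x−y|}/|x−y|)·w(y) dy = Σ_{n∈ℤ} c_n · e^{iζ|x−x_n|}/(4π|x−x_n|). Then w = 0 almost everywhere. -/

import Mathlib

open MeasureTheory
open scoped Real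

namespace GreenUniq

abbrev E3 := EuclideanSpace ℝ (Fin 3)

/-- The unnormalised Green's function. -/
noncomputable def gr (ζ : ℂ) (y : E3) : ℂ :=
  Complex.exp (Complex.I * ζ * (‖y‖ : ℂ)) / ((‖y‖ : ℝ) : ℂ)

noncomputable def sr (ε : ℝ) (y : E3) : ℝ := Real.sqrt (ε ^ 2 + ‖y‖ ^ 2)

noncomputable def h0 (ζ : ℂ) (s : ℝ) : ℂ := Complex.exp (Complex.I * ζ * s) / s
noncomputable def h1 (ζ : ℂ) (s : ℝ) : ℂ :=
  (Complex.I * ζ * s - 1) * Complex.exp (Complex.I * ζ * s) / s ^ 3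
noncomputable def h2 (ζ : ℂ) (s : ℝ) : ℂ :=
  (3 - 3 * (Complex.I * ζ * s) + (Complex.I * ζ * s) ^ 2) * Complex.exp (Complex.I * ζ * s) / s ^ 5

lemma sr_pos {ε : ℝ} (hε : 0 < ε) (y : E3) : 0 < sr ε y := by
  unfold sr; positivity

lemma sr_sq {ε : ℝ} (y : E3) : sr ε y ^ 2 = ε ^ 2 + ‖y‖ ^ 2 := by
  unfold sr; rw [Real.sq_sqrt]; positivity

lemma continuous_sr (ε : ℝ) : Continuous (sr ε) := by
  unfold sr; fun_prop

lemma exp_deriv (ζ : ℂ) (s : ℝ) :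
    HasDerivAt (fun s : ℝ => Complex.exp (Complex.I * ζ * s))
      (Complex.I * ζ * Complex.exp (Complex.I * ζ * s)) s := by
  have h : HasDerivAt (fun s : ℝ => Complex.I * ζ * (s : ℂ)) (Complex.I * ζ) s := by
    simpa using (Complex.ofRealCLM.hasDerivAt (x := s)).const_mul (Complex.I * ζ)
  have := h.cexp
  refine HasDerivAt.congr_deriv this ?_; ring

lemma h0_deriv (ζ : ℂ) {s : ℝ} (hs : 0 < s) : HasDerivAt (h0 ζ) (s * h1 ζ s) s := by
  have hs' : (s : ℂ) ≠ 0 := by exact_mod_cast hs.ne'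
  have hid : HasDerivAt (fun s : ℝ => (s : ℂ)) 1 s := Complex.ofRealCLM.hasDerivAt (x := s)
  have := (exp_deriv ζ s).div hid hs'
  refine HasDerivAt.congr_deriv this ?_
  unfold h1; field_simp

lemma h1_deriv (ζ : ℂ) {s : ℝ} (hs : 0 < s) : HasDerivAt (h1 ζ) (s * h2 ζ s) s := by
  have hs' : (s : ℂ) ≠ 0 := by exact_mod_cast hs.ne'
  have hid : HasDerivAt (fun s : ℝ => (s : ℂ)) 1 s := Complex.ofRealCLM.hasDerivAt (x := s)
  have := (((hid.const_mul (Complex.I * ζ)).sub_const 1).mul (exp_deriv ζ s)).div (hid.pow 3)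
    (pow_ne_zero 3 hs')
  refine HasDerivAt.congr_deriv this ?_
  simp only [h2, Pi.mul_apply, Pi.pow_apply]; field_simp
  push_cast
  ring

lemma continuous_h0 (ζ : ℂ) {ε : ℝ} (hε : 0 < ε) : Continuous fun y => h0 ζ (sr ε y) := by
  unfold h0
  have := continuous_sr ε
  refine Continuous.div (by fun_prop) (by fun_prop) fun y => by
    exact_mod_cast (sr_pos hε y).ne'

lemma continuous_h1 (ζ : ℂ) {ε : ℝ} (hε : 0 < ε) : Continuous fun y => h1 ζ (sr ε y) := by
  unfold h1
  have := continuous_sr ε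
  refine Continuous.div (by fun_prop) (by fun_prop) fun y => pow_ne_zero _ (by
    exact_mod_cast (sr_pos hε y).ne')

lemma continuous_h2 (ζ : ℂ) {ε : ℝ} (hε : 0 < ε) : Continuous fun y => h2 ζ (sr ε y) := by
  unfold h2
  have := continuous_sr ε
  refine Continuous.div (by fun_prop) (by fun_prop) fun y => pow_ne_zero _ (by
    exact_mod_cast (sr_pos hε y).ne')

noncomputable abbrev ee (i : Fin 3) : E3 := EuclideanSpace.single i (1 : ℝ)

lemma sr_deriv {ε : ℝ} (hε : 0 < ε) (y : E3) (i : Fin 3) :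
    HasLineDerivAt ℝ (sr ε) (y i / sr ε y) y (ee i) := by
  unfold HasLineDerivAt
  have e : (fun t : ℝ => sr ε (y + t • ee i)) =
      fun t => Real.sqrt (ε ^ 2 + (‖y‖ ^ 2 + 2 * (t * y i) + t ^ 2)) := by
    funext t
    unfold sr
    congr 2
    rw [norm_add_sq_real, inner_smul_right, norm_smul, EuclideanSpace.inner_single_right]
    simp
  rw [e]
  have h : HasDerivAt (fun t : ℝ => ε ^ 2 + (‖y‖ ^ 2 + 2 * (t * y i) + t ^ 2)) (2 * y i) 0 := by
    have h1 := ((((hasDerivAt_id (0 : ℝ)).mul_const (y i)).const_mul 2).const_add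
      (‖y‖ ^ 2)).add ((hasDerivAt_id (0 : ℝ)).pow 2)
    have := h1.const_add (ε ^ 2)
    refine HasDerivAt.congr_deriv this ?_
    simp
  have := h.sqrt (by simp; positivity)
  refine HasDerivAt.congr_deriv this ?_
  simp only [sr]
  simp
  field_simp

lemma comp_sr_deriv {ε : ℝ} (hε : 0 < ε) (y : E3) (i : Fin 3) {g : ℝ → ℂ} {g' : ℂ}
    (hg : HasDerivAt g (sr ε y * g') (sr ε y)) :
    HasLineDerivAt ℝ (fun y => g (sr ε y)) (g' * y i) y (ee i) := by
  have h := sr_deriv hε y i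
  unfold HasLineDerivAt at h ⊢
  have hg0 : HasDerivAt g (sr ε y * g') (sr ε (y + (0 : ℝ) • ee i)) := by simpa using hg
  have := HasDerivAt.scomp (0 : ℝ) hg0 h
  refine HasDerivAt.congr_deriv this ?_
  have hs' : (sr ε y : ℂ) ≠ 0 := by exact_mod_cast (sr_pos hε y).ne'
  rw [Complex.real_smul]; push_cast; field_simp

lemma deriv1 (ζ : ℂ) {ε : ℝ} (hε : 0 < ε) (y : E3) (i : Fin 3) :
    HasLineDerivAt ℝ (fun y => h0 ζ (sr ε y)) (h1 ζ (sr ε y) * y i) y (ee i) :=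
  comp_sr_deriv hε y i (h0_deriv ζ (sr_pos hε y))

lemma deriv2 (ζ : ℂ) {ε : ℝ} (hε : 0 < ε) (y : E3) (i : Fin 3) :
    HasLineDerivAt ℝ (fun y => h1 ζ (sr ε y) * (y i : ℂ))
      (h1 ζ (sr ε y) + h2 ζ (sr ε y) * y i ^ 2) y (ee i) := by
  have h := comp_sr_deriv hε y i (h1_deriv ζ (sr_pos hε y))
  unfold HasLineDerivAt at h ⊢
  have hc : HasDerivAt (fun t : ℝ => (((y + t • ee i) i : ℝ) : ℂ)) 1 0 := by
    have : (fun t : ℝ => (((y + t • ee i) i : ℝ) : ℂ)) = fun t : ℝ => (y i : ℂ) + (t : ℂ) := by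
      funext t; simp
    rw [this]
    exact (Complex.ofRealCLM.hasDerivAt (x := (0 : ℝ))).const_add _
  have := h.mul hc
  refine HasDerivAt.congr_deriv this ?_
  simp; ring

lemma laplace_id (ζ : ℂ) {ε : ℝ} (hε : 0 < ε) (y : E3) :
    -(∑ i, (h1 ζ (sr ε y) + h2 ζ (sr ε y) * (y i : ℂ) ^ 2)) - ζ ^ 2 * h0 ζ (sr ε y)
      = ε ^ 2 * h2 ζ (sr ε y) := by
  have hs' : (sr ε y : ℂ) ≠ 0 := by exact_mod_cast (sr_pos hε y).ne'
  have hsum : ∑ i, (y i : ℂ) ^ 2 = (sr ε y : ℂ) ^ 2 - ε ^ 2 := by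
    have : ∑ i, (y i) ^ 2 = (sr ε y) ^ 2 - ε ^ 2 := by
      rw [sr_sq, EuclideanSpace.real_norm_sq_eq]; ring
    exact_mod_cast this
  rw [Finset.sum_add_distrib, ← Finset.mul_sum, hsum]
  simp only [Finset.sum_const, Finset.card_univ, Fintype.card_fin, nsmul_eq_mul]
  simp only [h0, h1, h2]
  field_simp
  ring_nf
  simp only [Complex.I_sq]
  ring

/-- directional derivative -/
noncomputable def dd (i : Fin 3) (φ : E3 → ℂ) (y : E3) : ℂ := fderiv ℝ φ y (ee i)

/-- `-Δφ - ζ²φ` -/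
noncomputable def helm (ζ : ℂ) (φ : E3 → ℂ) (y : E3) : ℂ :=
  -(∑ i, dd i (dd i φ) y) - ζ ^ 2 * φ y

def IsTest (φ : E3 → ℂ) : Prop := ContDiff ℝ (⊤ : ℕ∞) φ ∧ HasCompactSupport φ

lemma IsTest.dd {φ : E3 → ℂ} (h : IsTest φ) (i : Fin 3) : IsTest (dd i φ) := by
  refine ⟨?_, ?_⟩
  · exact (h.1.fderiv_right (m := (⊤ : ℕ∞)) (by simp)).clm_apply contDiff_const
  · exact h.2.fderiv_apply (𝕜 := ℝ) (ee i)

lemma IsTest.integ {φ : E3 → ℂ} (h : IsTest φ) {f : E3 → ℂ} (hf : Continuous f) :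
    Integrable (fun y => f y * φ y) :=
  (hf.mul h.1.continuous).integrable_of_hasCompactSupport h.2.mul_left

lemma ibp {φ : E3 → ℂ} (h : IsTest φ) {f f' : E3 → ℂ} (i : Fin 3) (hf : Continuous f)
    (hf' : Continuous f') (hd : ∀ y, HasLineDerivAt ℝ f (f' y) y (ee i)) :
    ∫ y, f y * dd i φ y = - ∫ y, f' y * φ y := by
  refine integral_bilinear_hasLineDerivAt_right_eq_neg_left_of_integrable
    (B := ContinuousLinearMap.mul ℝ ℂ) (v := ee i) (h.integ hf') ((h.dd i).integ hf) (h.integ hf)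
    (fun y _ => hd y) (fun y _ => ?_)
  exact (((h.1.differentiable (by simp)) y).hasFDerivAt).hasLineDerivAt _

lemma reg_identity (ζ : ℂ) {ε : ℝ} (hε : 0 < ε) {φ : E3 → ℂ} (h : IsTest φ) :
    ∫ y, h0 ζ (sr ε y) * helm ζ φ y = ∫ y, ε ^ 2 * h2 ζ (sr ε y) * φ y := by
  have c0 := continuous_h0 ζ hε
  have c1 := continuous_h1 ζ hε
  have c2 := continuous_h2 ζ hε
  have key : ∀ i, ∫ y, h0 ζ (sr ε y) * dd i (dd i φ) y =
      ∫ y, (h1 ζ (sr ε y) + h2 ζ (sr ε y) * (y i : ℂ) ^ 2) * φ y := by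
    intro i
    rw [ibp (h.dd i) i c0 (f' := fun y => h1 ζ (sr ε y) * y i) (by fun_prop)
      (fun y => deriv1 ζ hε y i), ibp h i (f' := fun y => (h1 ζ (sr ε y) + h2 ζ (sr ε y) * (y i : ℂ) ^ 2))
        (by fun_prop) (by fun_prop)
      (fun y => deriv2 ζ hε y i), neg_neg]
  have e1 : ∀ y, h0 ζ (sr ε y) * helm ζ φ y =
      -(∑ i, h0 ζ (sr ε y) * dd i (dd i φ) y) - ζ ^ 2 * (h0 ζ (sr ε y) * φ y) := by
    intro y; unfold helm; rw [← Finset.mul_sum]; ring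
  have e2 : ∀ y, ε ^ 2 * h2 ζ (sr ε y) * φ y =
      -(∑ i, (h1 ζ (sr ε y) + h2 ζ (sr ε y) * (y i : ℂ) ^ 2) * φ y)
        - ζ ^ 2 * (h0 ζ (sr ε y) * φ y) := by
    intro y; rw [← laplace_id ζ hε, ← Finset.sum_mul]; ring
  simp_rw [e1, e2]
  have i0 : Integrable fun y => ζ ^ 2 * (h0 ζ (sr ε y) * φ y) := (h.integ c0).const_mul _
  rw [integral_sub _ i0, integral_sub _ i0, integral_neg, integral_neg, integral_finsetSum,
    integral_finsetSum]
  · simp_rw [key]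
  · exact fun i _ => h.integ (by fun_prop)
  · exact fun i _ => ((h.dd i).dd i).integ c0
  · exact (integrable_finsetSum _ fun i _ => h.integ (by fun_prop)).neg
  · exact (integrable_finsetSum _ fun i _ => ((h.dd i).dd i).integ c0).neg

lemma norm_exp' (ζ : ℂ) (s : ℝ) :
    ‖Complex.exp (Complex.I * ζ * s)‖ = Real.exp (-ζ.im * s) := by
  rw [Complex.norm_exp]; simp

lemma norm_gr (ζ : ℂ) (y : E3) : ‖gr ζ y‖ = Real.exp (-ζ.im * ‖y‖) / ‖y‖ := by
  unfold gr; rw [norm_div, norm_exp']; simp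

lemma measurable_gr (ζ : ℂ) : Measurable (gr ζ) := by
  unfold gr; fun_prop

lemma integrable_norm_gr {ζ : ℂ} (hζ : 0 < ζ.im) : Integrable (fun y => ‖gr ζ y‖) := by
  simp_rw [norm_gr]
  rw [integrable_fun_norm_addHaar (volume : Measure E3) (f := fun r => Real.exp (-ζ.im * r) / r)]
  have := integrableOn_rpow_mul_exp_neg_mul_rpow (p := 1) (s := 1) (b := ζ.im) (by norm_num)
    (by norm_num) hζ
  refine this.congr_fun (fun r hr => ?_) measurableSet_Ioi
  have : r ≠ 0 := (Set.mem_Ioi.1 hr).ne'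
  simp
  field_simp

lemma integrable_gr {ζ : ℂ} (hζ : 0 < ζ.im) : Integrable (gr ζ) :=
  (integrable_norm_iff (measurable_gr ζ).aestronglyMeasurable).1 (integrable_norm_gr hζ)

lemma integrable_gr_sq {ζ : ℂ} (hζ : 0 < ζ.im) : Integrable (fun y => ‖gr ζ y‖ ^ 2) := by
  simp_rw [norm_gr]
  rw [integrable_fun_norm_addHaar (volume : Measure E3)
    (f := fun r => (Real.exp (-ζ.im * r) / r) ^ 2)]
  have := integrableOn_rpow_mul_exp_neg_mul_rpow (p := 1) (s := 0) (b := 2 * ζ.im) (by norm_num)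
    (by norm_num) (by positivity)
  refine this.congr_fun (fun r hr => ?_) measurableSet_Ioi
  have : r ≠ 0 := (Set.mem_Ioi.1 hr).ne'
  simp only [Real.rpow_zero, Real.rpow_one, one_mul, finrank_euclideanSpace, Fintype.card_fin,
    smul_eq_mul, div_pow, ← Real.exp_nat_mul]
  field_simp
  congr 1
  push_cast
  ring_nf

lemma integrable_sr5 : Integrable (fun u : E3 => (sr 1 u ^ 5)⁻¹) := by
  have := integrable_rpow_neg_one_add_norm_sq (E := E3) (μ := volume) (r := 5)
    (by simp; norm_num)
  refine this.congr (Filter.Eventually.of_forall fun u => ?_)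
  simp only [sr, one_pow]
  have h : 0 ≤ 1 + ‖u‖ ^ 2 := by positivity
  generalize 1 + ‖u‖ ^ 2 = z at h
  rw [Real.sqrt_eq_rpow, ← Real.rpow_natCast, ← Real.rpow_mul h, ← Real.rpow_neg h]
  norm_num

lemma integral_sr5 : ∫ u : E3, (sr 1 u ^ 5)⁻¹ = 4 * π / 3 := by
  have hi := integrable_sr5
  have e : (fun u : E3 => (sr 1 u ^ 5)⁻¹) = fun u => (fun r : ℝ => (Real.sqrt (1 + r ^ 2) ^ 5)⁻¹) ‖u‖ := by
    funext u; simp [sr]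
  rw [e] at hi ⊢
  rw [integrable_fun_norm_addHaar (volume : Measure E3)
    (f := fun r : ℝ => (Real.sqrt (1 + r ^ 2) ^ 5)⁻¹)] at hi
  rw [integral_fun_norm_addHaar (volume : Measure E3)
    (fun r : ℝ => (Real.sqrt (1 + r ^ 2) ^ 5)⁻¹)]
  have hd : ∀ r : ℝ, HasDerivAt (fun r : ℝ => 3⁻¹ * (r / Real.sqrt (1 + r ^ 2)) ^ 3)
      (r ^ (Module.finrank ℝ E3 - 1) • (Real.sqrt (1 + r ^ 2) ^ 5)⁻¹) r := by
    intro r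
    have h0 : 0 < 1 + r ^ 2 := by positivity
    have h1 : HasDerivAt (fun r : ℝ => 1 + r ^ 2) (2 * r) r := by
      simpa using ((hasDerivAt_id r).pow 2).const_add 1
    have h2 := h1.sqrt h0.ne'
    have h3 := (((hasDerivAt_id r).div h2 (Real.sqrt_pos.2 h0).ne').pow 3).const_mul 3⁻¹
    refine HasDerivAt.congr_deriv h3 ?_
    have hp := Real.sqrt_pos.2 h0
    have hs := Real.sq_sqrt h0.le
    simp only [finrank_euclideanSpace, Fintype.card_fin, smul_eq_mul, id, Pi.div_apply]
    set s := Real.sqrt (1 + r ^ 2)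
    have e1 : s ^ 2 - r ^ 2 = 1 := by linarith
    have e2 : 3⁻¹ * (((3 : ℕ) : ℝ) * (r / s) ^ (3 - 1) * ((1 * s - r * (2 * r / (2 * s))) / s ^ 2))
        = r ^ (3 - 1) * (s ^ 2 - r ^ 2) * (s ^ 5)⁻¹ := by
      push_cast
      norm_num
      field_simp
    refine e2.trans ?_
    rw [e1, mul_one]
  have ht : Filter.Tendsto (fun r : ℝ => 3⁻¹ * (r / Real.sqrt (1 + r ^ 2)) ^ 3) Filter.atTop
      (nhds (3⁻¹ * 1 ^ 3)) := by
    refine Filter.Tendsto.const_mul _ (Filter.Tendsto.pow ?_ 3)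
    have h1 : Filter.Tendsto (fun r : ℝ => (Real.sqrt ((r ^ 2)⁻¹ + 1))⁻¹) Filter.atTop (nhds 1) := by
      have : Filter.Tendsto (fun r : ℝ => (r ^ 2)⁻¹) Filter.atTop (nhds 0) :=
        (Filter.tendsto_pow_atTop (by norm_num)).inv_tendsto_atTop
      have := ((this.add_const 1).sqrt).inv₀ (by simp)
      simpa using this
    refine h1.congr' ?_
    filter_upwards [Filter.eventually_gt_atTop 0] with r hr
    have : (r ^ 2)⁻¹ + 1 = (1 + r ^ 2) / r ^ 2 := by field_simp
    rw [this, Real.sqrt_div' _ (by positivity), Real.sqrt_sq hr.le, inv_div]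
  rw [integral_Ioi_of_hasDerivAt_of_tendsto (hd 0).continuousAt.continuousWithinAt
    (fun r _ => hd r) hi ht]
  simp only [Measure.real, EuclideanSpace.volume_ball_fin_three]
  simp
  rw [ENNReal.toReal_ofReal (by positivity)]
  ring

noncomputable def q (ζ : ℂ) (s : ℝ) : ℂ :=
  (3 - 3 * (Complex.I * ζ * s) + (Complex.I * ζ * s) ^ 2) * Complex.exp (Complex.I * ζ * s)

lemma continuous_q (ζ : ℂ) : Continuous (q ζ) := by unfold q; fun_prop

lemma q_bound {ζ : ℂ} (hζ : 0 < ζ.im) : ∃ C : ℝ, ∀ s : ℝ, 0 ≤ s → ‖q ζ s‖ ≤ C := by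
  refine ⟨3 + 3 * ‖ζ‖ / ζ.im + ‖ζ‖ ^ 2 * (2 / ζ.im ^ 2), fun s hs => ?_⟩
  have hη := mul_nonneg hζ.le hs
  have e0 : Real.exp (-ζ.im * s) ≤ 1 := Real.exp_le_one_iff.2 (by linarith)
  have e1 : s * Real.exp (-ζ.im * s) ≤ 1 / ζ.im := by
    have := Real.pow_div_factorial_le_exp (ζ.im * s) hη 1
    rw [neg_mul, Real.exp_neg, ← div_eq_mul_inv, div_le_div_iff₀ (Real.exp_pos _) hζ]
    simp at this; linarith
  have e2 : s ^ 2 * Real.exp (-ζ.im * s) ≤ 2 / ζ.im ^ 2 := by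
    have := Real.pow_div_factorial_le_exp (ζ.im * s) hη 2
    rw [neg_mul, Real.exp_neg, ← div_eq_mul_inv, div_le_div_iff₀ (Real.exp_pos _) (by positivity)]
    simp at this; linarith
  have hn : ‖Complex.I * ζ * s‖ = ‖ζ‖ * s := by simp [abs_of_nonneg hs]
  unfold q
  rw [norm_mul, norm_exp']
  have h3 : ‖3 - 3 * (Complex.I * ζ * s) + (Complex.I * ζ * s) ^ 2‖
      ≤ 3 + 3 * (‖ζ‖ * s) + (‖ζ‖ * s) ^ 2 := by
    refine (norm_add_le _ _).trans (add_le_add ((norm_sub_le _ _).trans ?_) ?_)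
    · rw [norm_mul, hn]; simp
    · rw [norm_pow, hn]
  calc _ ≤ (3 + 3 * (‖ζ‖ * s) + (‖ζ‖ * s) ^ 2) * Real.exp (-ζ.im * s) := by gcongr
    _ = 3 * Real.exp (-ζ.im * s) + 3 * ‖ζ‖ * (s * Real.exp (-ζ.im * s))
        + ‖ζ‖ ^ 2 * (s ^ 2 * Real.exp (-ζ.im * s)) := by ring
    _ ≤ 3 * 1 + 3 * ‖ζ‖ * (1 / ζ.im) + ‖ζ‖ ^ 2 * (2 / ζ.im ^ 2) := by gcongr
    _ = _ := by ring

lemma sr_smul {ε : ℝ} (hε : 0 < ε) (u : E3) : sr ε (ε • u) = ε * sr 1 u := by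
  unfold sr
  rw [norm_smul, Real.norm_of_nonneg hε.le,
    show ε ^ 2 + (ε * ‖u‖) ^ 2 = ε ^ 2 * (1 ^ 2 + ‖u‖ ^ 2) by ring,
    Real.sqrt_mul (by positivity), Real.sqrt_sq hε.le]

lemma scaled (ζ : ℂ) {ε : ℝ} (hε : 0 < ε) (φ : E3 → ℂ) :
    ∫ y, ε ^ 2 * h2 ζ (sr ε y) * φ y =
      ∫ u, q ζ (ε * sr 1 u) * (((sr 1 u ^ 5)⁻¹ : ℝ) : ℂ) * φ (ε • u) := by
  have := Measure.integral_comp_smul (volume : Measure E3)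
    (fun y => ε ^ 2 * h2 ζ (sr ε y) * φ y) ε
  have hε' : (ε : ℂ) ≠ 0 := by exact_mod_cast hε.ne'
  have h2' : ∫ y, ε ^ 2 * h2 ζ (sr ε y) * φ y =
      (ε : ℂ) ^ 3 * ∫ u : E3, ε ^ 2 * h2 ζ (sr ε (ε • u)) * φ (ε • u) := by
    rw [this]
    simp only [finrank_euclideanSpace, Fintype.card_fin, Complex.real_smul]
    rw [abs_of_pos (by positivity)]
    push_cast
    field_simp
  rw [h2', ← integral_const_mul]
  congr 1
  funext u
  rw [sr_smul hε]
  have hs : (sr 1 u : ℂ) ≠ 0 := by exact_mod_cast (sr_pos one_pos u).ne'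
  unfold h2 q
  push_cast
  field_simp

lemma IsTest.bound {φ : E3 → ℂ} (h : IsTest φ) : ∃ C : ℝ, 0 ≤ C ∧ ∀ y, ‖φ y‖ ≤ C := by
  obtain ⟨C, hC⟩ := h.1.continuous.bounded_above_of_compact_support h.2
  exact ⟨C, (norm_nonneg _).trans (hC 0), hC⟩

lemma limit_right {ζ : ℂ} (hζ : 0 < ζ.im) {φ : E3 → ℂ} (h : IsTest φ) :
    Filter.Tendsto (fun ε : ℝ => ∫ y, ε ^ 2 * h2 ζ (sr ε y) * φ y) (nhdsWithin 0 (Set.Ioi 0))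
      (nhds (4 * π * φ 0)) := by
  obtain ⟨C, hC⟩ := q_bound hζ
  obtain ⟨M, hM0, hM⟩ := h.bound
  have hq := continuous_q ζ
  have hs := continuous_sr 1
  have hφ := h.1.continuous
  have hsi : Continuous fun u => (sr 1 u ^ 5)⁻¹ :=
    (hs.pow 5).inv₀ fun u => (pow_pos (sr_pos one_pos u) 5).ne'
  have lim : Filter.Tendsto (fun ε : ℝ => ∫ u, q ζ (ε * sr 1 u) * (((sr 1 u ^ 5)⁻¹ : ℝ) : ℂ) * φ (ε • u))
      (nhdsWithin 0 (Set.Ioi 0)) (nhds (∫ u, q ζ 0 * (((sr 1 u ^ 5)⁻¹ : ℝ) : ℂ) * φ 0)) := by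
    refine tendsto_integral_filter_of_dominated_convergence (fun u => C * (sr 1 u ^ 5)⁻¹ * M)
      (Filter.Eventually.of_forall fun ε => ?_) ?_ ((integrable_sr5.const_mul C).mul_const M)
      (Filter.Eventually.of_forall fun u => ?_)
    · exact Continuous.aestronglyMeasurable (by fun_prop)
    · filter_upwards [self_mem_nhdsWithin] with ε hε
      refine Filter.Eventually.of_forall fun u => ?_
      have hp := sr_pos one_pos u
      have := hC (ε * sr 1 u) (mul_pos hε hp).le
      rw [norm_mul, norm_mul, Complex.norm_real, Real.norm_of_nonneg (by positivity)]
      have h0 := (norm_nonneg _).trans this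
      gcongr
      exact hM _
    · have : Continuous fun ε : ℝ => q ζ (ε * sr 1 u) * (((sr 1 u ^ 5)⁻¹ : ℝ) : ℂ) * φ (ε • u) := by
        fun_prop
      have := (this.tendsto 0).mono_left (nhdsWithin_le_nhds (s := Set.Ioi 0))
      simpa using this
  have h_int5 : ∫ u, (((sr 1 u ^ 5)⁻¹ : ℝ) : ℂ) = ((4 * π / 3 : ℝ) : ℂ) := by
    rw [← integral_sr5]; exact integral_ofReal
  have hval : ∫ u, q ζ 0 * (((sr 1 u ^ 5)⁻¹ : ℝ) : ℂ) * φ 0 = 4 * π * φ 0 := by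
    rw [integral_mul_const, integral_const_mul, h_int5]
    simp only [q]; push_cast; simp only [mul_zero, Complex.exp_zero]; ring
  rw [hval] at lim
  refine lim.congr' ?_
  filter_upwards [self_mem_nhdsWithin] with ε hε
  exact (scaled ζ hε φ).symm

lemma IsTest.helm {φ : E3 → ℂ} (h : IsTest φ) (ζ : ℂ) :
    Continuous (helm ζ φ) ∧ HasCompactSupport (helm ζ φ) := by
  have h2 := fun i => (h.dd i).dd i
  constructor
  · unfold GreenUniq.helm
    have := fun i => (h2 i).1.continuous
    have := h.1.continuous
    fun_prop
  · unfold GreenUniq.helm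
    simp only [Fin.sum_univ_three]
    exact (((h2 0).2.add (h2 1).2).add (h2 2).2).neg.sub h.2.mul_left

lemma limit_left {ζ : ℂ} (hζ : 0 < ζ.im) {φ : E3 → ℂ} (h : IsTest φ) :
    Filter.Tendsto (fun ε : ℝ => ∫ y, h0 ζ (sr ε y) * helm ζ φ y) (nhdsWithin 0 (Set.Ioi 0))
      (nhds (∫ y, gr ζ y * helm ζ φ y)) := by
  obtain ⟨hc, hcs⟩ := h.helm ζ
  obtain ⟨M, hM⟩ := hc.bounded_above_of_compact_support hcs
  have hne : ∀ᵐ y : E3, y ≠ 0 := by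
    simp [ae_iff]
  refine tendsto_integral_filter_of_dominated_convergence (fun y => ‖gr ζ y‖ * M) ?_ ?_
    ((integrable_norm_gr hζ).mul_const M) ?_
  · filter_upwards [self_mem_nhdsWithin] with ε hε
    exact ((continuous_h0 ζ hε).mul hc).aestronglyMeasurable
  · filter_upwards [self_mem_nhdsWithin] with ε hε
    filter_upwards [hne] with y hy
    rw [norm_mul]
    have hy' : 0 < ‖y‖ := norm_pos_iff.2 hy
    have hle : ‖y‖ ≤ sr ε y := by
      refine Real.le_sqrt_of_sq_le ?_
      nlinarith [sq_nonneg ε]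
    refine mul_le_mul ?_ (hM y) (norm_nonneg _) (norm_nonneg _)
    rw [norm_gr, h0, norm_div, norm_exp', Complex.norm_real, Real.norm_of_nonneg (sr_pos hε y).le]
    gcongr ?_ / ?_
    apply Real.exp_le_exp.2
    nlinarith
  · filter_upwards [hne] with y hy
    refine Filter.Tendsto.mul_const _ ?_
    have hy' : 0 < ‖y‖ := norm_pos_iff.2 hy
    have hs : Filter.Tendsto (fun ε => sr ε y) (nhdsWithin 0 (Set.Ioi 0)) (nhds ‖y‖) := by
      have : Continuous fun ε => sr ε y := by unfold sr; fun_prop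
      have := (this.tendsto 0).mono_left (nhdsWithin_le_nhds (s := Set.Ioi 0))
      simpa [sr] using this
    exact ((h0_deriv ζ hy').continuousAt.tendsto).comp hs

lemma green_zero {ζ : ℂ} (hζ : 0 < ζ.im) {φ : E3 → ℂ} (h : IsTest φ) :
    ∫ y, gr ζ y * helm ζ φ y = 4 * π * φ 0 := by
  refine tendsto_nhds_unique (limit_left hζ h) ((limit_right hζ h).congr' ?_)
  filter_upwards [self_mem_nhdsWithin] with ε hε
  exact (reg_identity ζ hε h).symm

lemma green {ζ : ℂ} (hζ : 0 < ζ.im) {φ : E3 → ℂ} (h : IsTest φ) (a : E3) :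
    ∫ y, gr ζ (y - a) * helm ζ φ y = 4 * π * φ a := by
  have ht : IsTest (fun y => φ (y + a)) :=
    ⟨h.1.comp (contDiff_id.add contDiff_const), h.2.comp_homeomorph (Homeomorph.addRight a)⟩
  have hd : ∀ i (f : E3 → ℂ), dd i (fun y => f (y + a)) = fun y => dd i f (y + a) := by
    intro i f; funext y; simp [dd, fderiv_comp_add_right]
  have := green_zero hζ ht
  rw [← integral_add_right_eq_self _ a]
  simp only [add_sub_cancel_right]
  simpa [helm, hd] using this

lemma gr_neg (ζ : ℂ) (a b : E3) : gr ζ (a - b) = gr ζ (b - a) := by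
  unfold gr; rw [norm_sub_rev]

lemma integrable_kernel {ζ : ℂ} (hζ : 0 < ζ.im) {ψ w : E3 → ℂ} (hψ : Integrable ψ)
    (hw : MemLp w 2 volume) :
    Integrable (fun p : E3 × E3 => ψ p.1 * (gr ζ (p.1 - p.2) * w p.2))
      ((volume : Measure E3).prod volume) := by
  have hw2 : Integrable fun y => ‖w y‖ ^ 2 := hw.norm.integrable_sq
  have i1 : Integrable (fun p : E3 × E3 => ‖ψ p.1‖ * ‖w p.2‖ ^ 2)
      ((volume : Measure E3).prod volume) := hψ.norm.mul_prod hw2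
  have i2 : Integrable (fun p : E3 × E3 => ‖ψ p.1‖ * ‖gr ζ (p.1 - p.2)‖ ^ 2)
      ((volume : Measure E3).prod volume) := by
    have := (Integrable.convolution_integrand (ContinuousLinearMap.mul ℝ ℝ) (μ := volume)
      (ν := volume) hψ.norm (integrable_gr_sq hζ)).swap
    refine this.congr (Filter.Eventually.of_forall fun p => ?_)
    simp [gr_neg ζ p.2 p.1]
  refine (i1.add i2).mono' ?_ (Filter.Eventually.of_forall fun p => ?_)
  · refine (hψ.1.comp_fst).mul (AEStronglyMeasurable.mul ?_ hw.1.comp_snd)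
    exact ((measurable_gr ζ).comp (measurable_fst.sub measurable_snd)).aestronglyMeasurable
  · simp only [norm_mul, Pi.add_apply]
    rw [← mul_add]
    refine mul_le_mul_of_nonneg_left ?_ (norm_nonneg _)
    nlinarith [sq_nonneg (‖gr ζ (p.1 - p.2)‖ - ‖w p.2‖), sq_nonneg ‖w p.2‖,
      sq_nonneg ‖gr ζ (p.1 - p.2)‖]

lemma pairing {ζ : ℂ} (hζ : 0 < ζ.im) (x : ℤ → E3) (c : ℤ → ℂ) (hc : Summable fun n => ‖c n‖)
    (w : E3 → ℂ) (hw : MemLp w 2 volume)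
    (heq : ∀ᵐ x' : E3, ∫ y, gr ζ (x' - y) * w y = ∑' n, c n * gr ζ (x' - x n))
    {φ : E3 → ℂ} (h : IsTest φ) :
    ∫ y, φ y * w y = ∑' n, c n * φ (x n) := by
  obtain ⟨hcont, hcs⟩ := h.helm ζ
  obtain ⟨M, hM⟩ := hcont.bounded_above_of_compact_support hcs
  have hM0 : 0 ≤ M := (norm_nonneg _).trans (hM 0)
  have hψ : Integrable (helm ζ φ) := hcont.integrable_of_hasCompactSupport hcs
  have left : ∫ x', helm ζ φ x' * ∫ y, gr ζ (x' - y) * w y = 4 * π * ∫ y, φ y * w y := by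
    simp_rw [← integral_const_mul]
    rw [integral_integral_swap (integrable_kernel hζ hψ hw)]
    congr 1
    funext y
    have := green hζ h y
    rw [← mul_assoc, ← this, ← integral_mul_const]
    congr 1; funext z; ring
  have igr : ∀ n, Integrable fun x' => gr ζ (x' - x n) := fun n => (integrable_gr hζ).comp_sub_right _
  have ipr : ∀ n, Integrable fun x' => gr ζ (x' - x n) * helm ζ φ x' := fun n =>
    (igr n).mul_bdd hcont.aestronglyMeasurable (Filter.Eventually.of_forall hM)
  have right : ∫ x', helm ζ φ x' * ∑' n, c n * gr ζ (x' - x n) = 4 * π * ∑' n, c n * φ (x n) := by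
    have hs := hasSum_integral_of_summable_integral_norm (μ := (volume : Measure E3))
      (F := fun n x' => c n * (gr ζ (x' - x n) * helm ζ φ x'))
      (fun n => (ipr n).const_mul _) (by
        refine Summable.of_nonneg_of_le (fun n => integral_nonneg fun _ => norm_nonneg _)
          (fun n => ?_) (hc.mul_right ((∫ y, ‖gr ζ y‖) * M))
        simp_rw [norm_mul]
        rw [integral_const_mul]
        refine mul_le_mul_of_nonneg_left ?_ (norm_nonneg _)
        rw [← integral_mul_const, ← integral_sub_right_eq_self (fun y => ‖gr ζ y‖ * M) (x n)]
        refine integral_mono ?_ ((igr n).norm.mul_const M) fun y =>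
          mul_le_mul_of_nonneg_left (hM y) (norm_nonneg _)
        simpa using (ipr n).norm)
    have e : ∀ x', helm ζ φ x' * ∑' n, c n * gr ζ (x' - x n) =
        ∑' n, c n * (gr ζ (x' - x n) * helm ζ φ x') := by
      intro x'; rw [← tsum_mul_left]; congr 1; funext n; ring
    simp_rw [e]
    rw [← hs.tsum_eq, ← tsum_mul_left]
    congr 1; funext n
    rw [integral_const_mul, green hζ h]; ring
  have hmid : ∫ x', helm ζ φ x' * ∫ y, gr ζ (x' - y) * w y =
      ∫ x', helm ζ φ x' * ∑' n, c n * gr ζ (x' - x n) := by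
    refine integral_congr_ae ?_
    filter_upwards [heq] with x' hx'
    rw [hx']
  rw [left, right] at hmid
  have hpi : (4 * π : ℂ) ≠ 0 := by
    have := Real.pi_ne_zero
    simp [this]
  exact mul_left_cancel₀ hpi hmid

lemma isTest_ofReal {g : E3 → ℝ} (h1 : ContDiff ℝ (⊤ : ℕ∞) g) (h2 : HasCompactSupport g) :
    IsTest (fun y => (g y : ℂ)) :=
  ⟨Complex.ofRealCLM.contDiff.comp h1, h2.comp_left (g := Complex.ofReal) rfl⟩

lemma coeff_zero (x : ℤ → E3) (hx : Function.Injective x) (c : ℤ → ℂ)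
    (hc : Summable fun n => ‖c n‖) (w : E3 → ℂ) (hw : LocallyIntegrable w volume)
    (hp : ∀ φ : E3 → ℂ, IsTest φ → ∫ y, φ y * w y = ∑' n, c n * φ (x n)) (m : ℤ) : c m = 0 := by
  let b : ℕ → ContDiffBump (x m) := fun k =>
    ⟨1 / (2 * (k + 1)), 1 / (k + 1), by positivity, by
      apply one_div_lt_one_div_of_lt <;> nlinarith [Nat.cast_nonneg (α := ℝ) k]⟩
  have hr : ∀ k, (b k).rOut = 1 / (k + 1) := fun k => rfl
  have hlim : ∀ y, y ≠ x m → Filter.Tendsto (fun k => ((b k y : ℝ) : ℂ)) Filter.atTop (nhds 0) := by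
    intro y hy
    refine tendsto_const_nhds.congr' ?_
    have hd : 0 < dist y (x m) := dist_pos.2 hy
    filter_upwards [tendsto_one_div_add_atTop_nhds_zero_nat.eventually_lt_const hd] with k hk
    rw [(b k).zero_of_le_dist (by rw [hr]; exact hk.le)]; simp
  have hone : ∀ k, b k (x m) = 1 := fun k => (b k).one_of_mem_closedBall (by simp; exact (b k).rIn_pos.le)
  have hle : ∀ k y, ‖((b k y : ℝ) : ℂ)‖ ≤ 1 := by
    intro k y
    rw [Complex.norm_real, Real.norm_of_nonneg (b k).nonneg]
    exact (b k).le_one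
  have T1 : Filter.Tendsto (fun k => ∑' n, c n * ((b k (x n) : ℝ) : ℂ)) Filter.atTop
      (nhds (∑' n, if n = m then c m else 0)) := by
    refine tendsto_tsum_of_dominated_convergence hc (fun n => ?_)
      (Filter.Eventually.of_forall fun k n => ?_)
    · split_ifs with hn
      · subst hn; simp [hone]
      · simpa using (hlim (x n) (fun h => hn (hx h))).const_mul (c n)
    · rw [norm_mul]
      exact mul_le_of_le_one_right (norm_nonneg _) (hle k _)
  rw [tsum_ite_eq] at T1
  have T2 : Filter.Tendsto (fun k => ∫ y, ((b k y : ℝ) : ℂ) * w y) Filter.atTop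
      (nhds (∫ _ : E3, (0 : ℂ))) := by
    refine tendsto_integral_of_dominated_convergence
      ((Metric.closedBall (x m) 1).indicator fun y => ‖w y‖) (fun k => ?_) ?_ (fun k => ?_) ?_
    · have : Continuous fun y => ((b k y : ℝ) : ℂ) :=
        Complex.continuous_ofReal.comp (b k).continuous
      exact this.aestronglyMeasurable.mul hw.aestronglyMeasurable
    · rw [integrable_indicator_iff measurableSet_closedBall]
      exact (hw.integrableOn_isCompact (isCompact_closedBall _ _)).norm
    · refine Filter.Eventually.of_forall fun y => ?_
      rw [norm_mul]
      by_cases hy : y ∈ Metric.closedBall (x m) 1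
      · rw [Set.indicator_of_mem hy]
        exact mul_le_of_le_one_left (norm_nonneg _) (hle k _)
      · rw [Set.indicator_of_notMem hy, (b k).zero_of_le_dist]
        · simp
        · rw [hr]
          rw [Metric.mem_closedBall, not_le] at hy
          refine le_trans ?_ hy.le
          rw [div_le_one (by positivity)]
          linarith [Nat.cast_nonneg (α := ℝ) k]
    · have hne : ∀ᵐ y : E3, y ≠ x m := by simp [ae_iff]
      filter_upwards [hne] with y hy
      simpa using (hlim y hy).mul_const (w y)
  rw [integral_zero] at T2
  refine tendsto_nhds_unique (T1.congr fun k => ?_) T2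
  exact (hp _ (isTest_ofReal (b k).contDiff (b k).hasCompactSupport)).symm

end GreenUniq

/-- Uniqueness statement (2.37) in the proof of Theorem 2.2 (triviality of
`G̃(z)ℓ² ∩ 𝔇(-Δ)`): if `w ∈ L²(ℝ³)` and the convolution of `w` with the
Helmholtz Green's function agrees a.e. with an absolutely convergent series
of shifted Green's functions `∑ c_n e^{iζ|x-x_n|}/(4π|x-x_n|)`, then `w = 0`
almost everywhere. -/
theorem green_convolution_uniqueness
    (ζ : ℂ) (hζ : 0 < ζ.im)
    (x : ℤ → EuclideanSpace ℝ (Fin 3)) (hx : Function.Injective x)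
    (hacc : ∀ C : Set (EuclideanSpace ℝ (Fin 3)), IsCompact C →
      Set.Finite {p : EuclideanSpace ℝ (Fin 3) |
        p ∈ C ∧ AccPt p (Filter.principal (Set.range x))})
    (c : ℤ → ℂ) (hc : Summable fun n : ℤ => ‖c n‖)
    (w : EuclideanSpace ℝ (Fin 3) → ℂ) (hw : MemLp w 2 volume)
    (heq : ∀ᵐ x' ∂(volume : Measure (EuclideanSpace ℝ (Fin 3))),
      (1 / (4 * π) : ℝ) •
          ∫ y : EuclideanSpace ℝ (Fin 3),
            (Complex.exp (Complex.I * ζ * (‖x' - y‖ : ℂ)) / ((‖x' - y‖ : ℝ) : ℂ)) * w y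
        = ∑' n : ℤ,
            c n * (Complex.exp (Complex.I * ζ * (‖x' - x n‖ : ℂ)) /
              ((4 * π * ‖x' - x n‖ : ℝ) : ℂ))) :
    w =ᵐ[volume] 0 := by
  have heq' : ∀ᵐ x' : GreenUniq.E3, ∫ y, GreenUniq.gr ζ (x' - y) * w y
      = ∑' n, c n * GreenUniq.gr ζ (x' - x n) := by
    filter_upwards [heq] with x' hx'
    have hpi : (4 * π : ℂ) ≠ 0 := by
      have := Real.pi_ne_zero
      simp [this]
    have e : ∑' n, c n * GreenUniq.gr ζ (x' - x n) = (4 * π : ℂ) * ∑' n : ℤ,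
            c n * (Complex.exp (Complex.I * ζ * (‖x' - x n‖ : ℂ)) /
              ((4 * π * ‖x' - x n‖ : ℝ) : ℂ)) := by
      rw [← tsum_mul_left]
      congr 1; funext n
      unfold GreenUniq.gr
      push_cast
      rw [mul_left_comm, ← mul_div_assoc (4 * π : ℂ), mul_div_mul_left _ _ hpi]
    rw [e, ← hx', Complex.real_smul]
    push_cast
    rw [← mul_assoc, mul_one_div_cancel hpi, one_mul]
    rfl
  have hloc : LocallyIntegrable w volume := hw.locallyIntegrable (by norm_num)
  have hp := fun φ (h : GreenUniq.IsTest φ) => GreenUniq.pairing hζ x c hc w hw heq' h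
  have hc0 := GreenUniq.coeff_zero x hx c hc w hloc hp
  refine ae_eq_zero_of_integral_contDiff_smul_eq_zero hloc fun g hg hgs => ?_
  have := hp _ (GreenUniq.isTest_ofReal hg hgs)
  simpa [hc0] using this
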